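/- Let p ≥ 2, α = p−1 and θ ≥ 0 with k₀ = p−1 (i.e. p an integer). For every σ ∈ (0, μ_{α,θ}) one has TMC(σ,α,θ) ≥ σ^{p−1}/(p−1)!. Moreover, if p > 2 then this inequality is strict: TMC(σ,α,θ) > σ^{p−1}/(p−1)! for all σ ∈ (0, μ_{α,θ}). -/

import Mathlib

open MeasureTheory Real Filter ENNReal

/-- The fractional-dimension spherical volume constant `ω_θ = 2π^((θ+1)/2)/Γ((θ+1)/2)`. -/
noncomputable def omegaW (θ : ℝ) : ℝ := 2 * Real.pi ^ ((θ + 1) / 2) / Real.Gamma ((θ + 1) / 2)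

/-- Weighted integral `∫₀^∞ f dλ_θ = ω_θ ∫₀^∞ f(r) r^θ dr` (for nonnegative integrands,
valued in `ℝ≥0∞`). -/
noncomputable def wInt (θ : ℝ) (f : ℝ → ℝ) : ℝ≥0∞ :=
  ENNReal.ofReal (omegaW θ) *
    ∫⁻ r in Set.Ioi (0 : ℝ), ENNReal.ofReal (f r) * ENNReal.ofReal (r ^ θ)

/-- The weighted Lebesgue norm `‖u‖_{L^q_θ}` (valued in `ℝ≥0∞`). -/
noncomputable def wNorm (θ q : ℝ) (u : ℝ → ℝ) : ℝ≥0∞ :=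
  (wInt θ fun r => |u r| ^ q) ^ (1 / q)

/-- Membership in the weighted Sobolev space `X = X^{1,p}_∞(α,θ)`:
`u` is locally absolutely continuous on `(0,∞)` with a.e. derivative `u'`
(expressed through the fundamental theorem of calculus on compact subintervals),
`u(r) → 0` as `r → ∞`, `‖u‖_{L^p_θ} < ∞` and `‖u'‖_{L^p_α} < ∞`. -/
structure MemX (p α θ : ℝ) (u u' : ℝ → ℝ) : Prop where
  ftc_int : ∀ a b : ℝ, 0 < a → a ≤ b → IntervalIntegrable u' MeasureTheory.volume a b
  ftc : ∀ a b : ℝ, 0 < a → a ≤ b → u b - u a = ∫ t in a..b, u' t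
  lim_zero : Filter.Tendsto u Filter.atTop (nhds 0)
  fin_u : wNorm θ p u < ⊤
  fin_u' : wNorm α p u' < ⊤

/-- Full norm on `X`: `‖u‖ = (‖u‖_{L^p_θ}^p + ‖u'‖_{L^p_α}^p)^{1/p}`. -/
noncomputable def Xnorm (p α θ : ℝ) (u u' : ℝ → ℝ) : ℝ≥0∞ :=
  ((wNorm θ p u) ^ p + (wNorm α p u') ^ p) ^ (1 / p)

/-- The truncated exponential `φ_p(t) = Σ_{j ∈ ℕ, j ≥ p-1} t^j / j!`. -/
noncomputable def phiP (p t : ℝ) : ℝ :=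
  ∑' j : ℕ, if p - 1 ≤ (j : ℝ) then t ^ j / (Nat.factorial j : ℝ) else 0

/-- The critical constant `μ_{α,θ} = (θ+1) ω_α^{1/α}`. -/
noncomputable def muC (α θ : ℝ) : ℝ := (θ + 1) * (omegaW α) ^ (1 / α)

/-- The Trudinger–Moser functional `∫₀^∞ φ_p(μ |u|^{p/(p-1)}) dλ_θ`. -/
noncomputable def TMfunc (p θ μ : ℝ) (u : ℝ → ℝ) : ℝ≥0∞ :=
  wInt θ fun r => phiP p (μ * |u r| ^ (p / (p - 1)))

/-- The subcritical Trudinger–Moser supremum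
`TMSC(μ,α,θ) = sup { ‖u‖_{L^p_θ}^{-p} ∫₀^∞ φ_p(μ|u|^{p/(p-1)}) dλ_θ : u ∈ X, u ≠ 0, ‖u'‖_{L^p_α} ≤ 1 }`. -/
noncomputable def TMSC (p α θ μ : ℝ) : ℝ≥0∞ :=
  ⨆ (u : ℝ → ℝ) (u' : ℝ → ℝ) (_ : MemX p α θ u u') (_ : u ≠ 0)
    (_ : wNorm α p u' ≤ 1), (wNorm θ p u) ^ (-p) * TMfunc p θ μ u

/-- The critical Trudinger–Moser supremum
`TMC(σ,α,θ) = sup { ∫₀^∞ φ_p(σ|u|^{p/(p-1)}) dλ_θ : u ∈ X, ‖u‖ ≤ 1 }`. -/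
noncomputable def TMC (p α θ σ : ℝ) : ℝ≥0∞ :=
  ⨆ (u : ℝ → ℝ) (u' : ℝ → ℝ) (_ : MemX p α θ u u') (_ : Xnorm p α θ u u' ≤ 1),
    TMfunc p θ σ u

/-- `k₀ = min { j ∈ ℕ : j ≥ p - 1 }`. -/
noncomputable def k0 (p : ℝ) : ℕ := sInf {j : ℕ | p - 1 ≤ (j : ℝ)}

/-- `TMC(σ,α,θ)` is attained by some `u ∈ X` with `‖u‖ ≤ 1`. -/
def TMCAttained (p α θ σ : ℝ) : Prop :=
  ∃ u u' : ℝ → ℝ, MemX p α θ u u' ∧ Xnorm p α θ u u' ≤ 1 ∧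
    TMC p α θ σ = TMfunc p θ σ u

/-- `σ_* = inf { σ ∈ (0, μ_{α,θ}) : TMC(σ,α,θ) is attained }`. -/
noncomputable def sigmaStar (p α θ : ℝ) : ℝ :=
  sInf {σ : ℝ | σ ∈ Set.Ioo 0 (muC α θ) ∧ TMCAttained p α θ σ}

theorem omegaW_pos {θ : ℝ} (hθ : 0 ≤ θ) : 0 < omegaW θ := by
  unfold omegaW
  have := Real.Gamma_pos_of_pos (show 0 < (θ + 1) / 2 by linarith)
  positivity

theorem wInt_mono {θ : ℝ} {f g : ℝ → ℝ} (h : ∀ r, f r ≤ g r) : wInt θ f ≤ wInt θ g := by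
  unfold wInt
  gcongr with r
  exact h r

theorem wInt_add {θ : ℝ} {f g : ℝ → ℝ} (hf : Measurable f) (hf0 : ∀ r, 0 ≤ f r)
    (hg0 : ∀ r, 0 ≤ g r) : wInt θ (fun r => f r + g r) = wInt θ f + wInt θ g := by
  unfold wInt
  rw [← mul_add, ← lintegral_add_left (by fun_prop)]
  congr 1
  refine lintegral_congr fun r => ?_
  rw [ENNReal.ofReal_add (hf0 r) (hg0 r), add_mul]

/-- Weighted integral of a decaying exponential, as a Gamma value. -/
theorem wInt_const_mul_exp {θ K m : ℝ} (hθ : 0 ≤ θ) (hK : 0 ≤ K) (hm : 0 < m) :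
    wInt θ (fun r => K * Real.exp (-(m * r))) =
      ENNReal.ofReal (K * (omegaW θ * ((1 / m) ^ (θ + 1) * Real.Gamma (θ + 1)))) := by
  have hint : ∫ r in Set.Ioi (0 : ℝ), r ^ (θ + 1 - 1) * Real.exp (-(m * r)) =
      (1 / m) ^ (θ + 1) * Real.Gamma (θ + 1) :=
    Real.integral_rpow_mul_exp_neg_mul_Ioi (by linarith) hm
  have hG := Real.Gamma_pos_of_pos (show 0 < θ + 1 by linarith)
  have hpos : 0 < (1 / m) ^ (θ + 1) * Real.Gamma (θ + 1) := by positivity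
  have hI : IntegrableOn (fun r : ℝ => r ^ (θ + 1 - 1) * Real.exp (-(m * r))) (Set.Ioi 0) := by
    by_contra h
    rw [integral_undef h] at hint
    exact hpos.ne hint
  have hω := omegaW_pos hθ
  unfold wInt
  have key : ∫⁻ r in Set.Ioi (0 : ℝ),
      ENNReal.ofReal (K * Real.exp (-(m * r))) * ENNReal.ofReal (r ^ θ) =
      ENNReal.ofReal (K * ((1 / m) ^ (θ + 1) * Real.Gamma (θ + 1))) := by
    rw [← hint, ← integral_const_mul, ofReal_integral_eq_lintegral_ofReal (hI.const_mul K)]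
    · refine setLIntegral_congr_fun measurableSet_Ioi fun r hr => ?_
      rw [← ENNReal.ofReal_mul (by positivity), add_sub_cancel_right]
      congr 1
      ring
    · filter_upwards [self_mem_ae_restrict measurableSet_Ioi] with r hr
      have : 0 < r := hr
      simp only [Pi.zero_apply]
      positivity
  rw [key, ← ENNReal.ofReal_mul hω.le]
  congr 1
  ring

theorem abs_mul_exp_rpow (c b s r : ℝ) :
    |c * Real.exp (-(b * r))| ^ s = |c| ^ s * Real.exp (-((s * b) * r)) := by
  rw [abs_mul, Real.abs_exp, Real.mul_rpow (abs_nonneg c) (Real.exp_pos _).le, ← Real.exp_mul]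
  congr 2
  ring

theorem wNorm_rpow {θ q : ℝ} (hq : 0 < q) (u : ℝ → ℝ) :
    (wNorm θ q u) ^ q = wInt θ fun r => |u r| ^ q := by
  rw [wNorm, ← ENNReal.rpow_mul, one_div_mul_cancel hq.ne', ENNReal.rpow_one]

theorem wInt_exp {θ q c b : ℝ} (hθ : 0 ≤ θ) (hq : 0 < q) (hb : 0 < b) :
    (wInt θ fun r => |c * Real.exp (-(b * r))| ^ q) =
      ENNReal.ofReal (|c| ^ q *
        (omegaW θ * ((1 / (q * b)) ^ (θ + 1) * Real.Gamma (θ + 1)))) := by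
  simp only [abs_mul_exp_rpow]
  exact wInt_const_mul_exp hθ (by positivity) (by positivity)

theorem memX_exp {p α θ c b : ℝ} (hp : 0 < p) (hα : 0 ≤ α) (hθ : 0 ≤ θ) (hb : 0 < b) :
    MemX p α θ (fun r => c * Real.exp (-(b * r))) (fun r => (-(c * b)) * Real.exp (-(b * r))) := by
  have hint : ∀ x y : ℝ, IntervalIntegrable (fun r => (-(c * b)) * Real.exp (-(b * r))) volume x y :=
    fun x y => (by fun_prop : Continuous fun r => (-(c * b)) * Real.exp (-(b * r))).intervalIntegrable x y
  refine ⟨fun x y _ _ => hint x y, fun x y _ _ => ?_, ?_, ?_, ?_⟩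
  · symm
    refine intervalIntegral.integral_eq_sub_of_hasDerivAt
      (f := fun r => c * Real.exp (-(b * r))) (fun r _ => ?_) (hint x y)
    have h := ((((hasDerivAt_id' r).const_mul b).fun_neg).exp).const_mul c
    exact h.congr_deriv (by ring)
  · have h : Tendsto (fun r : ℝ => Real.exp (-(b * r))) atTop (nhds 0) :=
      Real.tendsto_exp_neg_atTop_nhds_zero.comp (tendsto_id.const_mul_atTop hb)
    simpa using h.const_mul c
  · rw [wNorm, wInt_exp hθ hp hb]
    exact ENNReal.rpow_lt_top_of_nonneg (by positivity) ENNReal.ofReal_ne_top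
  · rw [wNorm, wInt_exp hα hp hb]
    exact ENNReal.rpow_lt_top_of_nonneg (by positivity) ENNReal.ofReal_ne_top

/-- For integer `p = n + 1`, the truncated exponential dominates its first two terms. -/
theorem two_terms_le_phiP {p t : ℝ} {n : ℕ} (hn : (n : ℝ) = p - 1) (ht : 0 ≤ t) :
    t ^ n / (n.factorial : ℝ) + t ^ (n + 1) / ((n + 1).factorial : ℝ) ≤ phiP p t := by
  have hnn : ∀ j : ℕ, 0 ≤ (if p - 1 ≤ (j : ℝ) then t ^ j / (Nat.factorial j : ℝ) else 0) := by
    intro j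
    split_ifs <;> positivity
  have hs : Summable fun j : ℕ => if p - 1 ≤ (j : ℝ) then t ^ j / (Nat.factorial j : ℝ) else 0 := by
    refine Summable.of_nonneg_of_le hnn (fun j => ?_) (Real.summable_pow_div_factorial t)
    split_ifs
    · exact le_rfl
    · positivity
  have h := hs.sum_le_tsum {n, n + 1} (fun j _ => hnn j)
  rw [Finset.sum_pair (by simp), if_pos hn.ge, if_pos (by push_cast; linarith)] at h
  exact h

/-- Testing the supremum with normalised exponentials `Y^(-1/p) exp (-b r)`, where `b` is fixed
by `ω_θ Γ(θ+1) (p b)^(-(θ+1)) + ω_α Γ(p) p^(-p) = Y`. -/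
theorem ofReal_le_TMC {p α θ σ Y : ℝ} {n : ℕ} (hp : 2 ≤ p) (hα : α = p - 1) (hθ : 0 ≤ θ)
    (hn : (n : ℝ) = p - 1) (hσ : 0 < σ)
    (hY : omegaW α * ((1 / p) ^ p * Real.Gamma p) < Y) :
    ENNReal.ofReal (σ ^ n / (n.factorial : ℝ) *
        ((Y - omegaW α * ((1 / p) ^ p * Real.Gamma p)) / Y) +
      σ ^ (n + 1) / ((n + 1).factorial : ℝ) * (Y ^ (-(p / (p - 1))) *
        ((p / (p - 1)) ^ (-(θ + 1)) *
          (Y - omegaW α * ((1 / p) ^ p * Real.Gamma p))))) ≤ TMC p α θ σ := by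
  set B := omegaW α * ((1 / p) ^ p * Real.Gamma p) with hB
  set q := p / (p - 1) with hq
  have hp0 : 0 < p := by linarith
  have hp1 : 0 < p - 1 := by linarith
  have hq0 : 0 < q := by positivity
  have hα0 : 0 ≤ α := by linarith
  have hα1 : α + 1 = p := by linarith
  have hΓ := Real.Gamma_pos_of_pos hp0
  have hΓθ := Real.Gamma_pos_of_pos (show 0 < θ + 1 by linarith)
  have hωα := omegaW_pos hα0
  have hω := omegaW_pos hθ
  have hB0 : 0 < B := by positivity
  have hY0 : 0 < Y := hB0.trans hY
  have hX0 : 0 < Y - B := sub_pos.2 hY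
  obtain ⟨b, hb, hbX⟩ : ∃ b : ℝ, 0 < b ∧
      omegaW θ * ((1 / (p * b)) ^ (θ + 1) * Real.Gamma (θ + 1)) = Y - B := by
    set Z := (Y - B) / (omegaW θ * Real.Gamma (θ + 1)) with hZ
    have hZ0 : 0 < Z := by positivity
    refine ⟨1 / (p * Z ^ (1 / (θ + 1))), by positivity, ?_⟩
    have h1 : 1 / (p * (1 / (p * Z ^ (1 / (θ + 1))))) = Z ^ (1 / (θ + 1)) := by
      field_simp
    rw [h1, ← Real.rpow_mul hZ0.le, one_div_mul_cancel (by linarith), Real.rpow_one, hZ]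
    field_simp
  set c := Y ^ (-(1 / p)) with hc
  have hc0 : 0 < c := by positivity
  have hcp : c ^ p = 1 / Y := by
    rw [hc, ← Real.rpow_mul hY0.le, neg_mul, one_div_mul_cancel hp0.ne', Real.rpow_neg_one,
      one_div]
  have hcqp : c ^ (q * p) = Y ^ (-q) := by
    rw [hc, ← Real.rpow_mul hY0.le]
    congr 1
    field_simp
  have hmem := memX_exp (c := c) hp0 hα0 hθ hb
  have hnorm : Xnorm p α θ (fun r => c * Real.exp (-(b * r)))
      (fun r => (-(c * b)) * Real.exp (-(b * r))) ≤ 1 := by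
    rw [Xnorm, wNorm_rpow hp0, wNorm_rpow hp0, wInt_exp hθ hp0 hb, wInt_exp hα0 hp0 hb, hbX,
      hα1, ← ENNReal.ofReal_add (by positivity) (by positivity)]
    have h1 : |c| ^ p * (Y - B) + |-(c * b)| ^ p *
        (omegaW α * ((1 / (p * b)) ^ p * Real.Gamma p)) = 1 := by
      rw [abs_neg, abs_of_pos hc0, abs_of_pos (mul_pos hc0 hb), Real.mul_rpow hc0.le hb.le, hcp,
        ← div_div, Real.div_rpow (by positivity) hb.le]
      have : b ^ p ≠ 0 := (Real.rpow_pos_of_pos hb p).ne'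
      have h2 : 1 / Y * b ^ p * (omegaW α * ((1 / p) ^ p / b ^ p * Real.Gamma p)) = 1 / Y * B := by
        rw [hB]
        field_simp
      rw [h2]
      field_simp
      ring
    rw [h1]
    simp
  refine le_trans ?_ (le_iSup₂_of_le (fun r => c * Real.exp (-(b * r)))
    (fun r => (-(c * b)) * Real.exp (-(b * r))) (le_iSup₂_of_le hmem hnorm le_rfl))
  have hlow : ∀ r : ℝ,
      σ ^ n / (n.factorial : ℝ) * c ^ p * Real.exp (-((p * b) * r)) +
        σ ^ (n + 1) / ((n + 1).factorial : ℝ) * c ^ (q * p) * Real.exp (-((q * p * b) * r)) ≤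
      phiP p (σ * |c * Real.exp (-(b * r))| ^ (p / (p - 1))) := by
    intro r
    refine le_trans (le_of_eq ?_) (two_terms_le_phiP hn (by positivity))
    have hx : 0 ≤ |c * Real.exp (-(b * r))| := abs_nonneg _
    have e1 : p / (p - 1) * (n : ℝ) = p := by rw [hn]; field_simp
    have e2 : p / (p - 1) * ((n + 1 : ℕ) : ℝ) = q * p := by push_cast; rw [hn, ← hq]; ring
    rw [mul_pow, mul_pow, ← Real.rpow_natCast (_ ^ (p / (p - 1))) n,
      ← Real.rpow_natCast (_ ^ (p / (p - 1))) (n + 1), ← Real.rpow_mul hx, ← Real.rpow_mul hx,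
      e1, e2, abs_mul_exp_rpow, abs_mul_exp_rpow, abs_of_pos hc0]
    ring
  refine le_trans (le_of_eq ?_) (wInt_mono hlow)
  rw [wInt_add (by fun_prop) (fun r => by positivity) (fun r => by positivity),
    wInt_const_mul_exp hθ (by positivity) (by positivity),
    wInt_const_mul_exp hθ (by positivity) (by positivity), hbX,
    ← ENNReal.ofReal_add (by positivity) (by positivity), hcp, hcqp, ← hbX]
  have h3 : (1 / (q * p * b)) ^ (θ + 1) = q ^ (-(θ + 1)) * (1 / (p * b)) ^ (θ + 1) := by
    rw [Real.rpow_neg hq0.le, ← Real.inv_rpow hq0.le, ← Real.mul_rpow (by positivity) (by positivity)]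
    congr 1
    field_simp
  rw [h3]
  congr 1
  ring

theorem stmt_18 (p α θ : ℝ) (hp : 2 ≤ p) (hα : α = p - 1) (hθ : 0 ≤ θ)
    (hk : (k0 p : ℝ) = p - 1) :
    ∀ σ : ℝ, 0 < σ → σ < muC α θ →
      ENNReal.ofReal (σ ^ (p - 1) / (Nat.factorial (k0 p) : ℝ)) ≤ TMC p α θ σ ∧
      (2 < p → ENNReal.ofReal (σ ^ (p - 1) / (Nat.factorial (k0 p) : ℝ)) < TMC p α θ σ) := by
  intro σ hσ _
  generalize k0 p = n at hk
  rw [← hk, Real.rpow_natCast]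
  have hlow := fun Y => ofReal_le_TMC (Y := Y) hp hα hθ hk hσ
  have hωα := omegaW_pos (show 0 ≤ α by linarith)
  have hΓ := Real.Gamma_pos_of_pos (show 0 < p by linarith)
  have hB0 : 0 < omegaW α * ((1 / p) ^ p * Real.Gamma p) := by
    have : 0 < p := by linarith
    positivity
  set B := omegaW α * ((1 / p) ^ p * Real.Gamma p)
  have hp1 : 0 < p - 1 := by linarith
  have hq0 : 0 < p / (p - 1) := div_pos (by linarith) hp1
  constructor
  · have hlim : Tendsto (fun Y : ℝ => ENNReal.ofReal (σ ^ n / (n.factorial : ℝ) * (1 - B * Y⁻¹)))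
        atTop (nhds (ENNReal.ofReal (σ ^ n / (n.factorial : ℝ)))) := by
      refine ENNReal.tendsto_ofReal ?_
      simpa using ((tendsto_inv_atTop_zero.const_mul B).const_sub 1).const_mul
        (σ ^ n / (n.factorial : ℝ))
    refine le_of_tendsto hlim ?_
    filter_upwards [eventually_gt_atTop B] with Y hY
    refine le_trans (ENNReal.ofReal_le_ofReal ?_) (hlow Y hY)
    have hY0 : 0 < Y := hB0.trans hY
    have hX0 : 0 < Y - B := sub_pos.2 hY
    have h1 : 1 - B * Y⁻¹ = (Y - B) / Y := by field_simp
    rw [h1]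
    exact le_add_of_nonneg_right (by positivity)
  · intro hp2
    set q := p / (p - 1) with hq
    have hq1 : 1 < q := by rw [hq, lt_div_iff₀ hp1]; linarith
    have hq2 : q < 2 := by rw [hq, div_lt_iff₀ hp1]; linarith
    have hD : 0 < σ ^ (n + 1) / ((n + 1).factorial : ℝ) * q ^ (-(θ + 1)) := by positivity
    set D := σ ^ (n + 1) / ((n + 1).factorial : ℝ) * q ^ (-(θ + 1))
    set E := σ ^ n / (n.factorial : ℝ)
    have hE0 : 0 < E := by positivity
    obtain ⟨Y, hYlarge, hYB, hY1⟩ := (((tendsto_rpow_atTop (sub_pos.2 hq2)).eventually_gt_atTop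
      (E * B / D + B)).and ((eventually_gt_atTop B).and (eventually_ge_atTop 1))).exists
    have hY0 : 0 < Y := hB0.trans hYB
    refine lt_of_lt_of_le ?_ (hlow Y hYB)
    rw [ENNReal.ofReal_lt_ofReal_iff_of_nonneg hE0.le]
    have hle : Y ^ (1 - q) ≤ 1 := Real.rpow_le_one_of_one_le_of_nonpos hY1 (by linarith)
    have e1 : Y ^ (2 - q) = Y ^ (1 - q) * Y := by
      rw [← Real.rpow_add_one hY0.ne']
      congr 1
      ring
    have e2 : Y ^ (-q) = Y ^ (1 - q) / Y := by
      rw [← Real.rpow_sub_one hY0.ne']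
      congr 1
      ring
    have hmain : E * B < D * (Y ^ (1 - q) * (Y - B)) := by
      have h1 : E * B / D < Y ^ (1 - q) * (Y - B) := by
        rw [e1] at hYlarge
        nlinarith
      rwa [div_lt_iff₀' hD] at h1
    have h2 : E * ((Y - B) / Y) + σ ^ (n + 1) / ((n + 1).factorial : ℝ) *
        (Y ^ (-q) * (q ^ (-(θ + 1)) * (Y - B))) =
        E + (D * (Y ^ (1 - q) * (Y - B)) - E * B) / Y := by
      rw [e2]
      simp only [D]
      field_simp
      ring
    rw [h2]
    have := div_pos (sub_pos.2 hmain) hY0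
    linarith
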